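/- Let M be a planar hypermap and x a dart with 0-successor y = α₀(x); let x₀ be the bottom of the open 0-orbit of x, and let M' = B M 0 x be M with the 0-link at x broken. Then y and x₀ lie in the same face of M if and only if x and y lie in distinct components of M'. In other words, breaking the 0-link at x disconnects the planar hypermap exactly when y and x₀ belong to the same face. -/

import Mathlib

open scoped Classical

/-- Dimensions 0 and 1. -/
inductive Dim : Type
  | zero : Dim
  | one : Dim
deriving DecidableEq

/-- Free maps: empty map, dart insertion, dart linking at a dimension. -/
inductive Fmap : Type
  | V : Fmap
  | I : Fmap → Nat → Fmap
  | L : Fmap → Dim → Nat → Nat → Fmap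

namespace Fmap

/-- The nil (exception) dart. -/
def nil : Nat := 0

/-- A dart exists in the map. -/
def exd : Fmap → Nat → Prop
  | V, _ => False
  | I m0 x, z => z = x ∨ exd m0 z
  | L m0 _ _ _, z => exd m0 z

/-- The (partial) k-successor α_k, with nil for undefined. -/
def A : Fmap → Dim → Nat → Nat
  | V, _, _ => nil
  | I m0 _, k, z => A m0 k z
  | L m0 k0 x y, k, z =>
      if k = k0 then (if z = x then y else A m0 k z) else A m0 k z

/-- The (partial) k-predecessor. -/
def A_1 : Fmap → Dim → Nat → Nat
  | V, _, _ => nil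
  | I m0 _, k, z => A_1 m0 k z
  | L m0 k0 x y, k, z =>
      if k = k0 then (if z = y then x else A_1 m0 k z) else A_1 m0 k z

/-- z has a k-successor. -/
def succd (m : Fmap) (k : Dim) (z : Nat) : Prop := A m k z ≠ nil

/-- z has a k-predecessor. -/
def predd (m : Fmap) (k : Dim) (z : Nat) : Prop := A_1 m k z ≠ nil

/-- Bottom dart of the open k-orbit of z. -/
def bottom : Fmap → Dim → Nat → Nat
  | V, _, _ => nil
  | I m0 x, k, z => if z = x then z else bottom m0 k z
  | L m0 k0 x y, k, z =>
      if k = k0 then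
        (if bottom m0 k z = y then bottom m0 k x else bottom m0 k z)
      else bottom m0 k z

/-- Top dart of the open k-orbit of z. -/
def top : Fmap → Dim → Nat → Nat
  | V, _, _ => nil
  | I m0 x, k, z => if z = x then z else top m0 k z
  | L m0 k0 x y, k, z =>
      if k = k0 then
        (if top m0 k z = x then top m0 k y else top m0 k z)
      else top m0 k z

/-- Closure of A: a permutation of existing darts. -/
def cA : Fmap → Dim → Nat → Nat
  | V, _, _ => nil
  | I m0 x, k, z => if z = x then z else cA m0 k z
  | L m0 k0 x y, k, z =>
      if k = k0 then
        (if z = x then y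
         else if z = top m0 k y then bottom m0 k x
         else cA m0 k z)
      else cA m0 k z

/-- Closure of A_1: the inverse permutation of cA. -/
def cA_1 : Fmap → Dim → Nat → Nat
  | V, _, _ => nil
  | I m0 x, k, z => if z = x then z else cA_1 m0 k z
  | L m0 k0 x y, k, z =>
      if k = k0 then
        (if z = y then x
         else if z = bottom m0 k x then top m0 k y
         else cA_1 m0 k z)
      else cA_1 m0 k z

/-- Precondition for inserting a dart. -/
def prec_I (m : Fmap) (x : Nat) : Prop := x ≠ nil ∧ ¬ exd m x

/-- Precondition for linking two darts at a dimension (keeping orbits open). -/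
def prec_L (m : Fmap) (k : Dim) (x y : Nat) : Prop :=
  exd m x ∧ exd m y ∧ ¬ succd m k x ∧ ¬ predd m k y ∧ cA m k x ≠ y

/-- The hypermap invariant. -/
def inv_hmap : Fmap → Prop
  | V => True
  | I m0 x => inv_hmap m0 ∧ prec_I m0 x
  | L m0 k0 x y => inv_hmap m0 ∧ prec_L m0 k0 x y

/-- The closed face map cF, corresponding to φ = α₁⁻¹ ∘ α₀⁻¹. -/
def cF (m : Fmap) (z : Nat) : Nat := cA_1 m Dim.one (cA_1 m Dim.zero z)

/-- Two darts are in the same face (existence of a cF-path). -/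
def expf (m : Fmap) (z t : Nat) : Prop := exd m z ∧ ∃ n : ℕ, (cF m)^[n] z = t

/-- Two darts are in the same edge (existence of a (cA zero)-path). -/
def expe (m : Fmap) (z t : Nat) : Prop := exd m z ∧ ∃ n : ℕ, (fun w => cA m Dim.zero w)^[n] z = t

/-- Two darts are in the same connected component. -/
def eqc : Fmap → Nat → Nat → Prop
  | V, _, _ => False
  | I m0 x, z, t => (z = x ∧ t = x) ∨ eqc m0 z t
  | L m0 _ x y, z, t =>
      eqc m0 z t ∨ (eqc m0 z x ∧ eqc m0 y t) ∨ (eqc m0 z y ∧ eqc m0 x t)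

/-- Number of darts. -/
def nd : Fmap → ℤ
  | V => 0
  | I m0 _ => nd m0 + 1
  | L m0 _ _ _ => nd m0

/-- Number of vertices. -/
def nv : Fmap → ℤ
  | V => 0
  | I m0 _ => nv m0 + 1
  | L m0 Dim.zero _ _ => nv m0
  | L m0 Dim.one _ _ => nv m0 - 1

/-- Number of edges. -/
def ne : Fmap → ℤ
  | V => 0
  | I m0 _ => ne m0 + 1
  | L m0 Dim.zero _ _ => ne m0 - 1
  | L m0 Dim.one _ _ => ne m0

/-- Number of faces. -/
noncomputable def nf : Fmap → ℤ
  | V => 0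
  | I m0 _ => nf m0 + 1
  | L m0 Dim.zero x y => if expf m0 (cA_1 m0 Dim.one x) y then nf m0 + 1 else nf m0 - 1
  | L m0 Dim.one x y => if expf m0 x (cA m0 Dim.zero y) then nf m0 + 1 else nf m0 - 1

/-- Number of connected components. -/
noncomputable def nc : Fmap → ℤ
  | V => 0
  | I m0 _ => nc m0 + 1
  | L m0 _ x y => if eqc m0 x y then nc m0 else nc m0 - 1

/-- Euler characteristic. -/
noncomputable def ec (m : Fmap) : ℤ := nv m + ne m + nf m - nd m

/-- Genus. -/
noncomputable def genus (m : Fmap) : ℤ := nc m - ec m / 2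

/-- Planarity. -/
def planar (m : Fmap) : Prop := genus m = 0

/-- Breaking the latest forward k-link of x. -/
def B : Fmap → Dim → Nat → Fmap
  | V, _, _ => V
  | I m0 x0, k, x => I (B m0 k x) x0
  | L m0 k0 x0 y0, k, x =>
      if k = k0 ∧ x = x0 then m0 else L (B m0 k x) k0 x0 y0

/-- Breaking all the 0-links of the darts of a list, first one first. -/
def Bl (m : Fmap) : List (Nat × Bool) → Fmap
  | [] => m
  | (x, _) :: l0 => Bl (B m Dim.zero x) l0

/-- The dart representing the face coded by a double-link (x, b). -/
def faceDart (m : Fmap) : Nat × Bool → Nat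
  | (x, b) => if b then A m Dim.zero x else bottom m Dim.zero x

/-- The edge of x is distinct from the edges of the darts of a list. -/
def distinct_edge_list (m : Fmap) (x : Nat) : List (Nat × Bool) → Prop
  | [] => True
  | (x', _) :: l0 => distinct_edge_list m x l0 ∧ ¬ expe m x x'

/-- Ring condition (0): unicity of edges, and each dart 0-linked. -/
def pre_ring0 (m : Fmap) : List (Nat × Bool) → Prop
  | [] => True
  | (x, _) :: l0 => pre_ring0 m l0 ∧ distinct_edge_list m x l0 ∧ succd m Dim.zero x

/-- Adjacency of the faces coded by two double-links. -/
def adjacent_faces (m : Fmap) : Nat × Bool → Nat × Bool → Prop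
  | (x, b), (x', b') =>
      let y := A m Dim.zero x
      let y' := A m Dim.zero x'
      let x0 := bottom m Dim.zero x
      let x'0 := bottom m Dim.zero x'
      if b then (if b' then expf m x0 y' else expf m x0 x'0)
      else (if b' then expf m y y' else expf m y x'0)

/-- Ring condition (1): continuity. -/
def pre_ring1 (m : Fmap) : List (Nat × Bool) → Prop
  | [] => True
  | xb :: l0 =>
      pre_ring1 m l0 ∧
      match l0 with
      | [] => True
      | xb' :: _ => adjacent_faces m xb xb'

/-- Last element of a list of double-links (with default). -/
def lastd : List (Nat × Bool) → Nat × Bool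
  | [] => (nil, true)
  | [a] => a
  | _ :: a :: l0 => lastd (a :: l0)

/-- Ring condition (2): circularity. -/
def pre_ring2 (m : Fmap) : List (Nat × Bool) → Prop
  | [] => True
  | (x, b) :: l0 =>
      match l0 with
      | [] => expf m (A m Dim.zero x) (bottom m Dim.zero x)
      | _ :: _ => adjacent_faces m (lastd l0) (x, b)

/-- The faces coded by two double-links are distinct. -/
def distinct_faces (m : Fmap) (xb xb' : Nat × Bool) : Prop :=
  ¬ expf m (faceDart m xb) (faceDart m xb')

/-- The face of xb is distinct from the faces of a list. -/
def distinct_face_list (m : Fmap) (xb : Nat × Bool) : List (Nat × Bool) → Prop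
  | [] => True
  | xb' :: l0 => distinct_face_list m xb l0 ∧ distinct_faces m xb xb'

/-- Ring condition (3): simplicity. -/
def pre_ring3 (m : Fmap) : List (Nat × Bool) → Prop
  | [] => True
  | xb :: l0 => pre_ring3 m l0 ∧ distinct_face_list m xb l0

/-- A ring of faces. -/
def ring (m : Fmap) (l : List (Nat × Bool)) : Prop :=
  l ≠ [] ∧ pre_ring0 m l ∧ pre_ring1 m l ∧ pre_ring2 m l ∧ pre_ring3 m l

end Fmap

set_option linter.unusedSimpArgs false
namespace Fmap

theorem exd_ne_nil {m : Fmap} (h : inv_hmap m) : ¬ exd m nil := by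
  induction m with
  | V => simp [exd]
  | I m x ih => 
    simp only [inv_hmap, prec_I] at h
    simp only [exd]
    have := ih h.1
    grind
  | L m k x y ih => exact ih h.1

theorem out_nil {m : Fmap} (h : inv_hmap m) (k : Dim) (z : Nat) (hz : ¬ exd m z) :
    A m k z = nil ∧ A_1 m k z = nil ∧ bottom m k z = nil ∧ top m k z = nil := by
  induction m with
  | V => simp [A, A_1, bottom, top]
  | I m x ih => 
    simp only [inv_hmap, prec_I, exd] at h hz
    have := ih h.1
    simp only [A, A_1, bottom, top]
    grind
  | L m k x y ih =>
    have := ih h.1 hz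
    have := exd_ne_nil h.1
    obtain ⟨h, p⟩ := h
    simp only [prec_L, exd] at p hz
    simp only [A, A_1, bottom, top]
    grind

structure Good (m : Fmap) (k : Dim) (z : Nat) : Prop where
  eb : exd m (bottom m k z)
  et : exd m (top m k z)
  bb : bottom m k (bottom m k z) = bottom m k z
  bt : bottom m k (top m k z) = bottom m k z
  tb : top m k (bottom m k z) = top m k z
  tt : top m k (top m k z) = top m k z
  pb : A_1 m k z = nil ↔ bottom m k z = z
  st : A m k z = nil ↔ top m k z = z
  cb : cA_1 m k (bottom m k z) = top m k z
  ct : cA m k (top m k z) = bottom m k z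

theorem good {m : Fmap} (h : inv_hmap m) : ∀ (k : Dim) (z : Nat), exd m z → Good m k z := by
  induction m with
  | V => simp [exd]
  | I m x ih =>
    intro k z hz
    simp only [inv_hmap, prec_I, exd] at h hz
    have ih := ih h.1 k z
    have o := out_nil h.1 k x h.2.2
    have n := exd_ne_nil h.1
    by_cases hx : z = x
    · subst hx
      constructor <;> simp [A, A_1, bottom, top, cA, cA_1, exd, o]
    · obtain ⟨_, _, _, _, _, _, _, _, _, _⟩ := ih (by tauto)
      constructor <;> simp only [A, A_1, bottom, top, cA, cA_1, exd] <;> grind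
  | L m k0 x y ih =>
    intro k z hz
    have n := exd_ne_nil h.1
    obtain ⟨h, p⟩ := h
    simp only [prec_L, exd, succd, predd, not_not] at p hz
    have ih := ih h
    by_cases hk : k = k0
    · subst hk
      obtain ⟨_, _, _, _, _, _, _, _, _, _⟩ := ih k z hz
      obtain ⟨_, _, _, _, _, _, _, _, _, _⟩ := ih k x p.1
      obtain ⟨_, _, _, _, _, _, _, _, _, _⟩ := ih k y p.2.1
      have hbz : bottom m k z = y ↔ top m k z = top m k y := by grind
      have htz : top m k z = x ↔ bottom m k z = bottom m k x := by grind
      have hxy : bottom m k x ≠ y := by grind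
      constructor <;> simp only [A, A_1, bottom, top, cA, cA_1, exd, if_true] <;> grind
    · obtain ⟨_, _, _, _, _, _, _, _, _, _⟩ := ih k z hz
      constructor <;> simp only [A, A_1, bottom, top, cA, cA_1, exd, if_neg hk] <;> assumption

structure Good2 (m : Fmap) (k : Dim) (z : Nat) : Prop where
  e : exd m (cA m k z)
  e1 : exd m (cA_1 m k z)
  i : cA m k (cA_1 m k z) = z
  j : cA_1 m k (cA m k z) = z

theorem good2 {m : Fmap} (h : inv_hmap m) : ∀ (k : Dim) (z : Nat), exd m z → Good2 m k z := by
  induction m with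
  | V => simp [exd]
  | I m x ih =>
    intro k z hz
    simp only [inv_hmap, prec_I, exd] at h hz
    have ih := ih h.1 k z
    by_cases hx : z = x
    · subst hx
      constructor <;> simp [cA, cA_1, exd]
    · obtain ⟨_, _, _, _⟩ := ih (by tauto)
      constructor <;> simp only [cA, cA_1, exd] <;> grind
  | L m k0 x y ih =>
    intro k z hz
    obtain ⟨h, p⟩ := h
    simp only [prec_L, exd, succd, predd, not_not] at p hz
    have ih := ih h
    by_cases hk : k = k0
    · subst hk
      obtain ⟨_, _, _, _⟩ := ih k z hz
      obtain ⟨_, _, _, _⟩ := ih k x p.1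
      obtain ⟨_, _, _, _⟩ := ih k y p.2.1
      obtain ⟨_, _, _, _, _, _, _, _, _, _⟩ := good h k x p.1
      obtain ⟨_, _, _, _, _, _, _, _, _, _⟩ := good h k y p.2.1
      constructor <;> simp only [cA, cA_1, exd, if_true] <;> grind
    · obtain ⟨_, _, _, _⟩ := ih k z hz
      constructor <;> simp only [cA, cA_1, exd, if_neg hk] <;> assumption

theorem eqc_exd {m : Fmap} (h : inv_hmap m) : ∀ z t, eqc m z t → exd m z ∧ exd m t := by
  induction m with
  | V => simp [eqc]
  | I m x ih => 
    have := ih h.1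
    simp only [eqc, exd]; grind
  | L m k x y ih =>
    have := ih h.1
    simp only [eqc, exd]; grind

theorem eqc_refl {m : Fmap} : ∀ z, exd m z → eqc m z z := by
  induction m with
  | V => simp [exd]
  | I m x ih => simp only [eqc, exd]; grind
  | L m k x y ih => simp only [eqc, exd]; grind

theorem eqc_symm {m : Fmap} : ∀ z t, eqc m z t → eqc m t z := by
  induction m with
  | V => simp [eqc]
  | I m x ih => simp only [eqc]; grind
  | L m k x y ih => simp only [eqc]; grind

theorem eqc_trans {m : Fmap} (h : inv_hmap m) : ∀ z t u, eqc m z t → eqc m t u → eqc m z u := by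
  induction m with
  | V => simp [eqc]
  | I m x ih => 
    have h' := h.2.2
    have := ih h.1
    have := eqc_exd h.1
    simp only [eqc]; grind
  | L m k x y ih =>
    have := ih h.1
    have := eqc_symm (m := m)
    simp only [eqc]; grind

theorem eqc_ops {m : Fmap} (h : inv_hmap m) : ∀ k z, exd m z →
    eqc m z (bottom m k z) ∧ eqc m z (top m k z) ∧ eqc m z (cA_1 m k z) := by
  induction m with
  | V => simp [exd]
  | I m x ih => 
    have := ih h.1
    simp only [eqc, exd, bottom, top, cA_1]; grind
  | L m k0 x y ih =>
    intro k z hz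
    have p := h.2
    have h := h.1
    simp only [prec_L, exd, succd, predd, not_not] at p hz
    have ih := ih h
    by_cases hk : k = k0
    · subst hk
      have := ih k z hz
      have := ih k x p.1
      have := ih k y p.2.1
      have sy := eqc_symm (m := m)
      have := eqc_trans h
      have := eqc_refl x p.1
      have := eqc_refl y p.2.1
      have := eqc_refl z hz
      obtain ⟨_, _, _, _, _, _, _, _, _, _⟩ := good h k x p.1
      obtain ⟨_, _, _, _, _, _, _, _, _, _⟩ := good h k y p.2.1
      simp only [bottom, top, cA_1, eqc, if_true]
      refine ⟨?_, ?_, ?_⟩ <;> grind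
    · have := ih k z hz
      simp only [bottom, top, cA_1, eqc, if_neg hk]
      tauto

theorem expf_eqc {m : Fmap} (h : inv_hmap m) {z t : Nat} (e : expf m z t) : eqc m z t := by
  obtain ⟨hz, n, rfl⟩ := e
  induction n generalizing z with
  | zero => exact eqc_refl z hz
  | succ n ih =>
    rw [Function.iterate_succ_apply]
    have h1 := eqc_ops h Dim.zero z hz
    have h2 := eqc_ops h Dim.one _ (good2 h Dim.zero z hz).e1
    have h3 := (good2 h Dim.one _ (good2 h Dim.zero z hz).e1).e1
    exact eqc_trans h _ _ _ (eqc_trans h _ _ _ h1.2.2 h2.2.2) (ih h3)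

structure Sim (m n : Fmap) : Prop where
  ex : exd m = exd n
  a : A m = A n
  a1 : A_1 m = A_1 n
  b : bottom m = bottom n
  t : top m = top n
  c : cA m = cA n
  c1 : cA_1 m = cA_1 n
  eq : eqc m = eqc n

theorem Sim.I {m n : Fmap} (s : Sim m n) (x : Nat) : Sim (I m x) (I n x) := by
  obtain ⟨h1, h2, h3, h4, h5, h6, h7, h8⟩ := s
  constructor <;> funext <;> simp only [exd, A, A_1, bottom, top, cA, cA_1, eqc, *]

theorem Sim.L {m n : Fmap} (s : Sim m n) (k : Dim) (x y : Nat) : Sim (L m k x y) (L n k x y) := by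
  obtain ⟨h1, h2, h3, h4, h5, h6, h7, h8⟩ := s
  constructor <;> funext <;> simp only [exd, A, A_1, bottom, top, cA, cA_1, eqc, *]

theorem Sim.trans {m n o : Fmap} (s : Sim m n) (r : Sim n o) : Sim m o :=
  ⟨s.1.trans r.1, s.2.trans r.2, s.3.trans r.3, s.4.trans r.4, s.5.trans r.5, s.6.trans r.6,
    s.7.trans r.7, s.8.trans r.8⟩

theorem Sim.prec_L {m n : Fmap} (s : Sim m n) {k : Dim} {x y : Nat} (p : prec_L m k x y) :
    prec_L n k x y := by
  simpa only [Fmap.prec_L, succd, predd, s.ex, s.a, s.a1, s.c] using p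

theorem comm_I {m : Fmap} {k : Dim} {x y z : Nat} (h : inv_hmap (I (L m k x y) z)) :
    inv_hmap (L (I m z) k x y) ∧ Sim (I (L m k x y) z) (L (I m z) k x y) := by
  obtain ⟨⟨h, p⟩, q⟩ := h
  simp only [prec_L, exd, succd, predd, not_not, prec_I] at p q
  obtain ⟨_, _, _, _, _, _, _, _, _, _⟩ := good h k x p.1
  obtain ⟨_, _, _, _, _, _, _, _, _, _⟩ := good h k y p.2.1
  refine ⟨⟨⟨h, ?_⟩, ?_⟩, ?_⟩
  · simpa only [prec_I] using q
  · simp only [prec_L, exd, succd, predd, not_not, A, A_1, cA]; grind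
  · have := eqc_exd h
    constructor <;> funext <;> simp only [exd, A, A_1, bottom, top, cA, cA_1, eqc] <;> grind

theorem comm_L {m : Fmap} {k k' : Dim} {x y x' y' : Nat}
    (h : inv_hmap (L (L m k x y) k' x' y')) (hn : ¬ (k = k' ∧ x = x')) :
    inv_hmap (L (L m k' x' y') k x y) ∧ Sim (L (L m k x y) k' x' y') (L (L m k' x' y') k x y) := by
  obtain ⟨⟨h, p⟩, q⟩ := h
  have n := exd_ne_nil h
  have he : eqc (L (L m k x y) k' x' y') = eqc (L (L m k' x' y') k x y) := by
    have := eqc_symm (m := m)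
    have := eqc_trans h
    funext z t
    simp only [eqc, eq_iff_iff]
    constructor <;> grind
  simp only [prec_L, exd, succd, predd, not_not, A, A_1, cA] at p q
  by_cases hk : k' = k
  · subst hk
    simp only [if_true] at p q
    have hxx : x' ≠ x := by grind
    have hyy : y' ≠ y := by grind
    obtain ⟨_, _, _, _, _, _, _, _, _, _⟩ := good h k' x p.1
    obtain ⟨_, _, _, _, _, _, _, _, _, _⟩ := good h k' y p.2.1
    obtain ⟨_, _, _, _, _, _, _, _, _, _⟩ := good h k' x' q.1
    obtain ⟨_, _, _, _, _, _, _, _, _, _⟩ := good h k' y' q.2.1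
    refine ⟨⟨⟨h, ?_⟩, ?_⟩, ?_⟩
    · simp only [prec_L, exd, succd, predd, not_not, A, A_1, cA]; grind
    · simp only [prec_L, exd, succd, predd, not_not, A, A_1, cA]; grind
    · refine ⟨rfl, ?_, ?_, ?_, ?_, ?_, ?_, he⟩ <;> funext kk z <;>
        simp only [exd, A, A_1, bottom, top, cA, cA_1] <;>
        by_cases hkk : kk = k' <;> simp only [hkk, if_true, if_false] <;> grind
  · have hk' : k ≠ k' := fun e => hk e.symm
    simp only [if_neg hk] at p q
    refine ⟨⟨⟨h, ?_⟩, ?_⟩, ?_⟩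
    · simp only [prec_L, exd, succd, predd, not_not, A, A_1, cA]; grind
    · simp only [prec_L, exd, succd, predd, not_not, A, A_1, cA]; grind
    · refine ⟨rfl, ?_, ?_, ?_, ?_, ?_, ?_, he⟩ <;> funext kk z <;>
        simp only [exd, A, A_1, bottom, top, cA, cA_1] <;> grind

theorem break_sim {m : Fmap} {k : Dim} {x : Nat} (h : inv_hmap m) (s : succd m k x) :
    inv_hmap (L (B m k x) k x (A m k x)) ∧ Sim m (L (B m k x) k x (A m k x)) := by
  induction m with
  | V => simp [succd, A] at s
  | I m z ih =>
    obtain ⟨h, q⟩ := h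
    obtain ⟨i1, i2⟩ := ih h s
    have : inv_hmap (I (L (B m k x) k x (A m k x)) z) := by
      refine ⟨i1, ?_⟩
      simpa only [prec_I, i2.ex] using q
    obtain ⟨j1, j2⟩ := comm_I this
    exact ⟨j1, (i2.I z).trans j2⟩
  | L m k' x' y' ih =>
    by_cases hk : k = k' ∧ x = x'
    · obtain ⟨rfl, rfl⟩ := hk
      simp only [B, A, and_self, if_true]
      exact ⟨h, ⟨rfl, rfl, rfl, rfl, rfl, rfl, rfl, rfl⟩⟩
    · obtain ⟨h, q⟩ := h
      have hA : A (L m k' x' y') k x = A m k x := by simp only [A]; grind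
      rw [succd, hA] at s
      obtain ⟨i1, i2⟩ := ih h s
      obtain ⟨j1, j2⟩ := comm_L (⟨i1, i2.prec_L q⟩ : inv_hmap (L (L (B m k x) k x (A m k x)) k' x' y')) hk
      rw [hA]
      simp only [B, if_neg hk]
      exact ⟨j1, (i2.L _ _ _).trans j2⟩

theorem break_counts {m : Fmap} {x : Nat} (s : succd m Dim.zero x) :
    nd (B m Dim.zero x) = nd m ∧ nv (B m Dim.zero x) = nv m ∧ ne (B m Dim.zero x) = ne m + 1 := by
  induction m with
  | V => simp [succd, A] at s
  | I m z ih =>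
    have := ih s
    simp only [B, nd, nv, ne]; grind
  | L m k' x' y' ih =>
    by_cases hk : Dim.zero = k' ∧ x = x'
    · obtain ⟨rfl, rfl⟩ := hk
      simp [B, nd, nv, ne]
    · have hA : A (L m k' x' y') Dim.zero x = A m Dim.zero x := by simp only [A]; grind
      rw [succd, hA] at s
      have := ih s
      simp only [B, if_neg hk]
      cases k' <;> simp only [nd, nv, ne] <;> grind

theorem genus_nonneg {m : Fmap} (h : inv_hmap m) : ec m % 2 = 0 ∧ 0 ≤ genus m := by
  induction m with
  | V => simp [genus, ec, nd, nv, ne, nf, nc]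
  | I m z ih =>
    have := ih h.1
    simp only [genus, ec, nd, nv, ne, nf, nc] at *; omega
  | L m k x y ih =>
    have ih := ih h.1
    obtain ⟨h, p⟩ := h
    have hs := eqc_symm (m := m)
    have ht := eqc_trans h
    cases k
    · have : ¬ eqc m x y → ¬ expf m (cA_1 m Dim.one x) y := fun a b =>
        a (ht _ _ _ (eqc_ops h Dim.one x p.1).2.2 (expf_eqc h b))
      simp only [genus, ec, nd, nv, ne, nf, nc] at *
      split_ifs <;> grind
    · have : ¬ eqc m x y → ¬ expf m x (cA m Dim.zero y) := fun a b => by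
        have g := good2 h Dim.zero y p.2.1
        have := (eqc_ops h Dim.zero _ g.e).2.2
        rw [g.j] at this
        exact a (ht _ _ _ (expf_eqc h b) this)
      simp only [genus, ec, nd, nv, ne, nf, nc] at *
      split_ifs <;> grind

end Fmap
namespace Fmap

/-- Reachability by iteration of f, started in D. -/
def Rch (D : Finset ℕ) (f : ℕ → ℕ) (z t : ℕ) : Prop := z ∈ D ∧ ∃ n : ℕ, f^[n] z = t

/-- Number of classes of r on D. -/
noncomputable def ncl (D : Finset ℕ) (r : ℕ → ℕ → Prop) : ℤ :=
  ((D.image (fun z => {t | r z t})).card : ℤ)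

structure Eqv (D : Finset ℕ) (R : ℕ → ℕ → Prop) : Prop where
  m : ∀ z t, R z t → z ∈ D ∧ t ∈ D
  r : ∀ z, z ∈ D → R z z
  s : ∀ z t, R z t → R t z
  t : ∀ z t u, R z t → R t u → R z u

theorem Eqv.cls {D : Finset ℕ} {r : ℕ → ℕ → Prop} (e : Eqv D r) {z t : ℕ} (hz : z ∈ D) :
    ({u | r z u} : Set ℕ) = {u | r t u} ↔ r z t := by
  constructor
  · intro h
    have : z ∈ ({u | r t u} : Set ℕ) := h ▸ e.r z hz
    exact e.s _ _ this
  · intro h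
    ext u
    exact ⟨fun a => e.t _ _ _ (e.s _ _ h) a, fun a => e.t _ _ _ h a⟩

theorem ncl_join {D : Finset ℕ} {r r' : ℕ → ℕ → Prop} (e : Eqv D r) {a b : ℕ} (ha : a ∈ D)
    (hb : b ∈ D) (hab : ¬ r a b)
    (h : ∀ z t, r' z t ↔ r z t ∨ (r z a ∧ r b t) ∨ (r z b ∧ r a t)) :
    ncl D r = ncl D r' + 1 := by
  have hs := e.s
  have ht := e.t
  have hr := e.r
  set D' := D.filter (fun z => ¬ r z a ∧ ¬ r z b) with hD
  have h1 : D.image (fun z => ({t | r z t} : Set ℕ)) =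
      insert {t | r a t} (insert {t | r b t} (D'.image (fun z => {t | r z t}))) := by
    ext S
    simp only [Finset.mem_image, Finset.mem_insert, hD, Finset.mem_filter]
    constructor
    · rintro ⟨z, hz, rfl⟩
      by_cases c1 : r z a
      · left; exact (e.cls hz).2 c1
      by_cases c2 : r z b
      · right; left; exact (e.cls hz).2 c2
      · right; right; exact ⟨z, ⟨hz, c1, c2⟩, rfl⟩
    · rintro (rfl | rfl | ⟨z, hz, rfl⟩)
      · exact ⟨a, ha, rfl⟩
      · exact ⟨b, hb, rfl⟩
      · exact ⟨z, hz.1, rfl⟩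
  have h2 : D.image (fun z => ({t | r' z t} : Set ℕ)) =
      insert {t | r a t ∨ r b t} (D'.image (fun z => {t | r z t})) := by
    ext S
    simp only [Finset.mem_image, Finset.mem_insert, hD, Finset.mem_filter]
    constructor
    · rintro ⟨z, hz, rfl⟩
      by_cases c1 : r z a
      · left; ext t; simp only [Set.mem_setOf_eq, h]; grind
      by_cases c2 : r z b
      · left; ext t; simp only [Set.mem_setOf_eq, h]; grind
      · right; refine ⟨z, ⟨hz, c1, c2⟩, ?_⟩
        ext t; simp only [Set.mem_setOf_eq, h]; grind
    · rintro (rfl | ⟨z, ⟨hz, c1, c2⟩, rfl⟩)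
      · refine ⟨a, ha, ?_⟩
        ext t; simp only [Set.mem_setOf_eq, h]; grind
      · refine ⟨z, hz, ?_⟩
        ext t; simp only [Set.mem_setOf_eq, h]; grind
  have n1 : ({t | r a t} : Set ℕ) ∉ insert ({t | r b t} : Set ℕ) (D'.image (fun z => {t | r z t})) := by
    simp only [Finset.mem_image, Finset.mem_insert, hD, Finset.mem_filter]
    rintro (c | ⟨z, ⟨hz, c1, c2⟩, c⟩)
    · exact hab ((e.cls ha).1 c)
    · exact c1 ((e.cls hz).1 c)
  have n2 : ({t | r b t} : Set ℕ) ∉ (D'.image (fun z => ({t | r z t} : Set ℕ))) := by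
    simp only [Finset.mem_image, hD, Finset.mem_filter]
    rintro ⟨z, ⟨hz, c1, c2⟩, c⟩
    exact c2 ((e.cls hz).1 c)
  have n3 : ({t | r a t ∨ r b t} : Set ℕ) ∉ (D'.image (fun z => ({t | r z t} : Set ℕ))) := by
    simp only [Finset.mem_image, hD, Finset.mem_filter]
    rintro ⟨z, ⟨hz, c1, c2⟩, c⟩
    have : a ∈ ({t | r z t} : Set ℕ) := by rw [c]; exact Or.inl (hr a ha)
    exact c1 this
  unfold ncl
  rw [h1, h2, Finset.card_insert_of_notMem n1, Finset.card_insert_of_notMem n2,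
    Finset.card_insert_of_notMem n3]
  push_cast; ring

theorem ncl_insert {D : Finset ℕ} {r r' : ℕ → ℕ → Prop} (e : Eqv D r) {x : ℕ} (hx : x ∉ D)
    (h : ∀ z t, r' z t ↔ (z = x ∧ t = x) ∨ r z t) :
    ncl (insert x D) r' = ncl D r + 1 := by
  have hm := e.m
  have h1 : (insert x D).image (fun z => ({t | r' z t} : Set ℕ)) =
      insert {x} (D.image (fun z => {t | r z t})) := by
    rw [Finset.image_insert]
    congr 1
    · ext t; simp only [Set.mem_setOf_eq, h, Set.mem_singleton_iff]; grind
    · apply Finset.image_congr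
      intro z hz
      ext t; simp only [Set.mem_setOf_eq, h]; grind
  have n1 : ({x} : Set ℕ) ∉ D.image (fun z => ({t | r z t} : Set ℕ)) := by
    simp only [Finset.mem_image]
    rintro ⟨z, hz, c⟩
    have : x ∈ ({t | r z t} : Set ℕ) := by rw [c]; rfl
    exact hx (hm _ _ this).2
  unfold ncl
  rw [h1, Finset.card_insert_of_notMem n1]
  push_cast; ring

structure Prm (D : Finset ℕ) (f : ℕ → ℕ) : Prop where
  m : ∀ z ∈ D, f z ∈ D
  i : ∀ z ∈ D, ∀ t ∈ D, f z = f t → z = t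

theorem Prm.it {D : Finset ℕ} {f : ℕ → ℕ} (p : Prm D f) {z : ℕ} (hz : z ∈ D) (n : ℕ) :
    f^[n] z ∈ D := by
  induction n with
  | zero => exact hz
  | succ n ih => rw [Function.iterate_succ_apply']; exact p.m _ ih

theorem Prm.per {D : Finset ℕ} {f : ℕ → ℕ} (p : Prm D f) {z : ℕ} (hz : z ∈ D) :
    ∃ n, 0 < n ∧ f^[n] z = z := by
  let g : D → D := fun u => ⟨f u.1, p.m _ u.2⟩
  have gi : Function.Injective g := by
    intro u v h
    exact Subtype.ext (p.i _ u.2 _ v.2 (congrArg Subtype.val h))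
  obtain ⟨n, hn, h⟩ := gi.mem_periodicPts ⟨z, hz⟩
  refine ⟨n, hn, ?_⟩
  have key : ∀ n (u : D), (g^[n] u).1 = f^[n] u.1 := by
    intro n
    induction n with
    | zero => intro u; rfl
    | succ n ih => intro u; rw [Function.iterate_succ_apply, Function.iterate_succ_apply, ih]
  have := key n ⟨z, hz⟩
  rw [h] at this
  exact this.symm

theorem Prm.step {D : Finset ℕ} {f : ℕ → ℕ} {z : ℕ} (hz : z ∈ D) : Rch D f z (f z) :=
  ⟨hz, 1, rfl⟩

theorem Prm.eqv {D : Finset ℕ} {f : ℕ → ℕ} (p : Prm D f) : Eqv D (Rch D f) where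
  m := by
    rintro z t ⟨hz, n, rfl⟩
    exact ⟨hz, p.it hz n⟩
  r := fun z hz => ⟨hz, 0, rfl⟩
  t := by
    rintro z t u ⟨hz, n, rfl⟩ ⟨_, k, rfl⟩
    exact ⟨hz, k + n, Function.iterate_add_apply _ _ _ _⟩
  s := by
    rintro z t ⟨hz, n, rfl⟩
    refine ⟨p.it hz n, ?_⟩
    obtain ⟨q, hq, h⟩ := p.per hz
    refine ⟨q * n - n, ?_⟩
    rw [← Function.iterate_add_apply, Nat.sub_add_cancel (Nat.le_mul_of_pos_left n hq)]
    rw [Function.iterate_mul]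
    exact Function.iterate_fixed h n

/-- A relation containing steps contains reachability. -/
theorem Rch.sub {D : Finset ℕ} {f : ℕ → ℕ} (p : Prm D f) {r : ℕ → ℕ → Prop} (e : Eqv D r)
    (h : ∀ z ∈ D, r z (f z)) {z t : ℕ} (H : Rch D f z t) : r z t := by
  obtain ⟨hz, n, rfl⟩ := H
  induction n with
  | zero => exact e.r _ hz
  | succ n ih =>
    rw [Function.iterate_succ_apply']
    exact e.t _ _ _ ih (h _ (p.it hz n))

/-- g is f precomposed with the transposition of a and b. -/
structure Tr (D : Finset ℕ) (f g : ℕ → ℕ) (a b : ℕ) : Prop where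
  ha : a ∈ D
  hb : b ∈ D
  ab : a ≠ b
  ga : g a = f b
  gb : g b = f a
  go : ∀ z ∈ D, z ≠ a → z ≠ b → g z = f z

theorem Tr.prm {D : Finset ℕ} {f g : ℕ → ℕ} {a b : ℕ} (p : Prm D f) (t : Tr D f g a b) :
    Prm D g := by
  obtain ⟨ha, hb, ab, ga, gb, go⟩ := t
  have m := p.m
  have i := p.i
  constructor
  · intro z hz
    grind
  · intro z hz t ht h
    by_cases z = a <;> by_cases z = b <;> by_cases t = a <;> by_cases t = b <;> grind

theorem Tr.symm {D : Finset ℕ} {f g : ℕ → ℕ} {a b : ℕ} (t : Tr D f g a b) : Tr D g f a b := by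
  obtain ⟨ha, hb, ab, ga, gb, go⟩ := t
  exact ⟨ha, hb, ab, gb.symm, ga.symm, fun z h1 h2 h3 => (go z h1 h2 h3).symm⟩

theorem Tr.swap {D : Finset ℕ} {f g : ℕ → ℕ} {a b : ℕ} (t : Tr D f g a b) : Tr D f g b a := by
  obtain ⟨ha, hb, ab, ga, gb, go⟩ := t
  exact ⟨hb, ha, ab.symm, gb, ga, fun z h1 h2 h3 => go z h1 h3 h2⟩

theorem Tr.sep {D : Finset ℕ} {f g : ℕ → ℕ} {a b : ℕ} (p : Prm D f) (t : Tr D f g a b)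
    (h : Rch D f a b) : ¬ Rch D g b a := by
  obtain ⟨ha, hb, ab, ga, gb, go⟩ := t
  have hex := h.2
  set k := Nat.find hex with hk
  have h1 : f^[k] a = b := Nat.find_spec hex
  have h2 : ∀ j, j < k → f^[j] a ≠ b := fun j hj => Nat.find_min hex hj
  have k0 : 0 < k := by
    rcases Nat.eq_zero_or_pos k with h | h
    · rw [h] at h1; exact absurd h1 ab
    · exact h
  have h3 : ∀ j, 1 ≤ j → j ≤ k → f^[j] a ≠ a := by
    intro j j1 j2 hj
    apply h2 (k - j) (by omega)
    rw [← h1]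
    conv_rhs => rw [← Nat.sub_add_cancel j2, Function.iterate_add_apply, hj]
  have key : ∀ n, ∃ j, 1 ≤ j ∧ j ≤ k ∧ g^[n] b = f^[j] a := by
    intro n
    induction n with
    | zero => exact ⟨k, k0, le_rfl, h1.symm⟩
    | succ n ih =>
      obtain ⟨j, j1, j2, hj⟩ := ih
      rw [Function.iterate_succ_apply', hj]
      rcases Nat.lt_or_ge j k with c | c
      · refine ⟨j + 1, by omega, c, ?_⟩
        rw [go _ (p.it ha j) (h3 j j1 j2) (h2 j c), Function.iterate_succ_apply']
      · have : j = k := le_antisymm j2 c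
        rw [this, h1, gb]
        exact ⟨1, le_rfl, k0, rfl⟩
  rintro ⟨_, n, hn⟩
  obtain ⟨j, j1, j2, hj⟩ := key n
  exact h3 j j1 j2 (hj ▸ hn)

theorem Tr.mrg {D : Finset ℕ} {f g : ℕ → ℕ} {a b : ℕ} (p : Prm D f) (t : Tr D f g a b)
    (h : ¬ Rch D f a b) : Rch D g b a := by
  obtain ⟨ha, hb, ab, ga, gb, go⟩ := t
  have hex := p.per ha
  set k := Nat.find hex with hk
  have h1 : 0 < k ∧ f^[k] a = a := Nat.find_spec hex
  have h2 : ∀ j, j < k → ¬ (0 < j ∧ f^[j] a = a) := fun j hj => Nat.find_min hex hj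
  have key : ∀ j, j + 1 ≤ k → g^[j + 1] b = f^[j + 1] a := by
    intro j
    induction j with
    | zero => intro _; exact gb
    | succ j ih =>
      intro hj
      rw [Function.iterate_succ_apply', ih (by omega), Function.iterate_succ_apply' f (j + 1)]
      apply go _ (p.it ha _)
      · intro c; exact h2 (j + 1) (by omega) ⟨by omega, c⟩
      · intro c; exact h ⟨ha, _, c⟩
  refine ⟨hb, k, ?_⟩
  have := key (k - 1) (by omega)
  rw [Nat.sub_add_cancel h1.1] at this
  rw [this, h1.2]

theorem Tr.iff {D : Finset ℕ} {f g : ℕ → ℕ} {a b : ℕ} (p : Prm D f) (t : Tr D f g a b) :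
    Rch D g a b ↔ ¬ Rch D f a b := by
  have s := (t.prm p).eqv.s
  exact ⟨fun h1 h2 => t.sep p h2 (s _ _ h1), fun h => s _ _ (t.mrg p h)⟩

theorem Tr.cnt1 {D : Finset ℕ} {f g : ℕ → ℕ} {a b : ℕ} (p : Prm D f) (t : Tr D f g a b)
    (h : ¬ Rch D f a b) : ncl D (Rch D f) = ncl D (Rch D g) + 1 := by
  have q := t.prm p
  have hg := (t.iff p).2 h
  apply ncl_join p.eqv t.ha t.hb h
  have hm := p.eqv.m
  have hr := p.eqv.r
  have hs := p.eqv.s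
  have ht := p.eqv.t
  have gs := q.eqv.s
  have gt := q.eqv.t
  have ga := t.ha
  have gb := t.hb
  have hsub : ∀ z t, Rch D f z t → Rch D g z t := by
    intro z u hz
    refine Rch.sub p q.eqv ?_ hz
    intro z hz
    by_cases c : z = a
    · subst c; rw [← t.gb]; exact gt _ _ _ hg (Prm.step t.hb)
    by_cases c : z = b
    · subst c; rw [← t.ga]; exact gt _ _ _ (gs _ _ hg) (Prm.step t.ha)
    · rw [← t.go z hz (by assumption) c]; exact Prm.step hz
  intro z u
  constructor
  · refine Rch.sub (r := fun z u => Rch D f z u ∨ (Rch D f z a ∧ Rch D f b u) ∨ (Rch D f z b ∧ Rch D f a u)) q ⟨?_, ?_, ?_, ?_⟩ ?_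
    · intro z u; grind
    · intro z u; grind
    · intro z u; grind
    · intro z u; grind
    · intro z hz
      by_cases c : z = a
      · subst c; rw [t.ga]; exact Or.inr (Or.inl ⟨hr _ hz, Prm.step t.hb⟩)
      by_cases c : z = b
      · subst c; rw [t.gb]; exact Or.inr (Or.inr ⟨hr _ hz, Prm.step t.ha⟩)
      · rw [t.go z hz (by assumption) c]; exact Or.inl (Prm.step hz)
  · rintro (c | ⟨c, d⟩ | ⟨c, d⟩)
    · exact hsub _ _ c
    · exact gt _ _ _ (hsub _ _ c) (gt _ _ _ hg (hsub _ _ d))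
    · exact gt _ _ _ (hsub _ _ c) (gt _ _ _ (gs _ _ hg) (hsub _ _ d))

theorem Tr.cnt {D : Finset ℕ} {f g : ℕ → ℕ} {a b : ℕ} (p : Prm D f) (t : Tr D f g a b) :
    ncl D (Rch D g) = if Rch D f a b then ncl D (Rch D f) + 1 else ncl D (Rch D f) - 1 := by
  split_ifs with h
  · exact t.symm.cnt1 (t.prm p) (fun c => (t.iff p).1 c h)
  · have := t.cnt1 p h
    omega

/-- The darts of a map. -/
def dts : Fmap → Finset ℕ
  | V => ∅
  | I m x => insert x (dts m)
  | L m _ _ _ => dts m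

theorem mem_dts {m : Fmap} {z : ℕ} : z ∈ dts m ↔ exd m z := by
  induction m with
  | V => simp [dts, exd]
  | I m x ih => simp [dts, exd, ih]
  | L m k x y ih => simp [dts, exd, ih]

theorem expf_rch {m : Fmap} : expf m = Rch (dts m) (cF m) := by
  funext z t
  simp only [expf, Rch, mem_dts]

theorem prm_cF {m : Fmap} (h : inv_hmap m) : Prm (dts m) (cF m) := by
  constructor
  · intro z hz
    rw [mem_dts] at *
    exact (good2 h _ _ (good2 h _ _ hz).e1).e1
  · intro z hz t ht e
    rw [mem_dts] at *
    unfold cF at e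
    have g1 := good2 h Dim.zero z hz
    have g2 := good2 h Dim.zero t ht
    have g3 := good2 h Dim.one _ g1.e1
    have g4 := good2 h Dim.one _ g2.e1
    have := congrArg (cA m Dim.one) e
    rw [g3.i, g4.i] at this
    have := congrArg (cA m Dim.zero) this
    rwa [g1.i, g2.i] at this

theorem tr0 {m : Fmap} {x y : ℕ} (h : inv_hmap (L m Dim.zero x y)) :
    Tr (dts m) (cF m) (cF (L m Dim.zero x y)) y (bottom m Dim.zero x) := by
  obtain ⟨h, p⟩ := h
  simp only [prec_L, exd, succd, predd, not_not] at p
  obtain ⟨_, _, _, _, _, _, _, _, _, _⟩ := good h Dim.zero x p.1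
  obtain ⟨_, _, _, _, _, _, _, _, _, _⟩ := good h Dim.zero y p.2.1
  constructor <;> try simp only [cF, cA_1, mem_dts, reduceCtorEq, if_true, if_false]
  all_goals grind

theorem tr1 {m : Fmap} {x y : ℕ} (h : inv_hmap (L m Dim.one x y)) :
    Tr (dts m) (cF m) (cF (L m Dim.one x y)) (cA m Dim.zero (bottom m Dim.one x))
      (cA m Dim.zero y) := by
  obtain ⟨h, p⟩ := h
  simp only [prec_L, exd, succd, predd, not_not] at p
  obtain ⟨eb, _, _, _, _, _, _, _, _, _⟩ := good h Dim.one x p.1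
  obtain ⟨_, _, _, _, _, _, _, _, _, _⟩ := good h Dim.one y p.2.1
  obtain ⟨_, _, _, _⟩ := good2 h Dim.zero y p.2.1
  obtain ⟨_, _, _, _⟩ := good2 h Dim.zero _ eb
  have := good2 h Dim.zero
  constructor <;> try simp only [cF, cA_1, mem_dts, reduceCtorEq, if_true, if_false]
  · grind
  · grind
  · grind
  · grind
  · grind
  · intro z hz
    obtain ⟨_, _, _, _⟩ := this z hz
    grind

theorem nf_eq {m : Fmap} (h : inv_hmap m) : nf m = ncl (dts m) (expf m) := by
  induction m with
  | V => simp [nf, ncl, dts]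
  | I m x ih =>
    obtain ⟨h, q⟩ := h
    have hx : x ∉ dts m := by rw [mem_dts]; exact q.2
    have p := prm_cF h
    have e1 : cF (I m x) x = x := by simp [cF, cA_1]
    have e2 : ∀ z, z ∈ dts m → cF (I m x) z = cF m z := by
      intro z hz
      rw [mem_dts] at hz hx
      have := (good2 h Dim.zero z hz).e1
      simp only [cF, cA_1]; grind
    have it1 : ∀ n, (cF (I m x))^[n] x = x := fun n => Function.iterate_fixed e1 n
    have it2 : ∀ n z, z ∈ dts m → (cF (I m x))^[n] z = (cF m)^[n] z := by
      intro n z hz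
      induction n with
      | zero => rfl
      | succ n ih => rw [Function.iterate_succ_apply', ih, Function.iterate_succ_apply',
          e2 _ (p.it hz n)]
    rw [nf, ih h, dts, expf_rch (m := m), ← ncl_insert p.eqv hx]
    intro z t
    simp only [expf, Rch, exd]
    constructor
    · rintro ⟨c, n, rfl⟩
      by_cases hz : z = x
      · subst hz; left; exact ⟨rfl, it1 n⟩
      · have hz' : z ∈ dts m := mem_dts.2 (by tauto)
        right; exact ⟨hz', n, (it2 n z hz').symm⟩
    · rintro (⟨rfl, rfl⟩ | ⟨c, n, rfl⟩)
      · exact ⟨Or.inl rfl, 0, rfl⟩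
      · exact ⟨Or.inr (mem_dts.1 c), n, it2 n z c⟩
  | L m k x y ih =>
    have p := prm_cF h.1
    have i := ih h.1
    rw [expf_rch] at i ⊢
    have hs := p.eqv.s
    have ht := p.eqv.t
    cases k
    · have t := tr0 h
      rw [dts, t.cnt p, nf, i, expf_rch]
      have hst := Prm.step (f := cF m) t.hb
      have : cF m (bottom m Dim.zero x) = cA_1 m Dim.one x := by
        have g := good h.1 Dim.zero x h.2.1
        rw [cF, g.cb, g.st.1 (by simpa [succd] using h.2.2.2.1)]
      rw [this] at hst
      have : Rch (dts m) (cF m) y (bottom m Dim.zero x) ↔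
          Rch (dts m) (cF m) (cA_1 m Dim.one x) y := by grind
      simp only [this]
    · have t := tr1 h
      rw [dts, t.cnt p, nf, i, expf_rch]
      have hst := Prm.step (f := cF m) t.ha
      have : cF m (cA m Dim.zero (bottom m Dim.one x)) = x := by
        have g := good h.1 Dim.one x h.2.1
        rw [cF, (good2 h.1 Dim.zero _ g.eb).j, g.cb, g.st.1 (by simpa [succd] using h.2.2.2.1)]
      rw [this] at hst
      have : Rch (dts m) (cF m) (cA m Dim.zero (bottom m Dim.one x)) (cA m Dim.zero y) ↔
          Rch (dts m) (cF m) x (cA m Dim.zero y) := by grind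
      simp only [this]

theorem eqv_eqc {m : Fmap} (h : inv_hmap m) : Eqv (dts m) (eqc m) where
  m := by simpa only [mem_dts] using eqc_exd h
  r := by simpa only [mem_dts] using eqc_refl
  s := eqc_symm
  t := eqc_trans h

theorem nc_eq {m : Fmap} (h : inv_hmap m) : nc m = ncl (dts m) (eqc m) := by
  induction m with
  | V => simp [nc, ncl, dts]
  | I m x ih =>
    obtain ⟨h, q⟩ := h
    have hx : x ∉ dts m := by rw [mem_dts]; exact q.2
    rw [nc, ih h, dts, ← ncl_insert (eqv_eqc h) hx]
    intro z t
    simp only [eqc]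
  | L m k x y ih =>
    obtain ⟨h, p⟩ := h
    rw [nc, dts, ih h]
    have e := eqv_eqc h
    split_ifs with c
    · congr 1
      funext z t
      have := eqc_symm (m := m)
      have := eqc_trans h
      simp only [eqc]; grind
    · have := ncl_join (r' := eqc (L m k x y)) e (mem_dts.2 p.1) (mem_dts.2 p.2.1) c
        (fun z t => by simp only [eqc])
      omega

end Fmap
namespace Fmap

theorem sim_counts {m n : Fmap} (h : inv_hmap m) (h' : inv_hmap n) (s : Sim m n) :
    expf m = expf n ∧ nf m = nf n ∧ nc m = nc n := by
  have hd : dts m = dts n := by ext z; rw [mem_dts, mem_dts, s.ex]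
  have he : expf m = expf n := by
    have hc : cF m = cF n := by funext z; simp only [cF, s.c1]
    rw [expf_rch, expf_rch, hd, hc]
  exact ⟨he, by rw [nf_eq h, nf_eq h', hd, he], by rw [nc_eq h, nc_eq h', hd, s.eq]⟩

theorem main_L {m : Fmap} {x y : ℕ} (h : inv_hmap (L m Dim.zero x y))
    (pl : planar (L m Dim.zero x y)) :
    expf (L m Dim.zero x y) y (bottom (L m Dim.zero x y) Dim.zero x) ↔ ¬ eqc m x y := by
  have t := tr0 h
  have p := prm_cF h.1
  have hb : bottom (L m Dim.zero x y) Dim.zero x = bottom m Dim.zero x := by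
    have := t.ab
    simp only [bottom]; grind
  have hst := Prm.step (f := cF m) t.hb
  have hc : cF m (bottom m Dim.zero x) = cA_1 m Dim.one x := by
    have g := good h.1 Dim.zero x h.2.1
    rw [cF, g.cb, g.st.1 (by simpa [succd] using h.2.2.2.1)]
  rw [hc] at hst
  have hs := p.eqv.s
  have ht := p.eqv.t
  have key : Rch (dts m) (cF m) y (bottom m Dim.zero x) ↔ expf m (cA_1 m Dim.one x) y := by
    rw [expf_rch]; grind
  rw [hb, expf_rch, dts, t.iff p, key]
  constructor
  · intro hn he
    have g := genus_nonneg h.1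
    simp only [planar, genus, ec, nd, nv, ne, nf, nc, if_neg hn, if_pos he] at pl g
    omega
  · intro hn he
    exact hn (eqc_trans h.1 _ _ _ (eqc_ops h.1 Dim.one x h.2.1).2.2 (expf_eqc h.1 he))

end Fmap

open Fmap
/-- Disconnection criterion for planar hypermaps under a 0-link break. -/
theorem disconnect_planar_criterion_B0 (m : Fmap) (x : Nat)
    (h1 : inv_hmap m) (h2 : planar m) (h3 : succd m Dim.zero x) :
    expf m (A m Dim.zero x) (bottom m Dim.zero x) ↔
      ¬ eqc (B m Dim.zero x) x (A m Dim.zero x) := by 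
  obtain ⟨i, s⟩ := break_sim h1 h3
  obtain ⟨c1, c2, c3⟩ := break_counts h3
  obtain ⟨e1, e2, e3⟩ := sim_counts h1 i s
  have pl : planar (L (B m Dim.zero x) Dim.zero x (A m Dim.zero x)) := by
    have hd : ec (L (B m Dim.zero x) Dim.zero x (A m Dim.zero x)) = ec m := by
      unfold ec
      rw [← e2]
      simp only [nd, nv, ne, c1, c2, c3]
      ring
    unfold planar genus at h2 ⊢
    rw [hd, ← e3, h2]
  have := main_L i pl
  rwa [← e1, ← s.b] at this
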